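/- Let (Σ, L, κ) be a state property system satisfying the axiom OrthoCom. For every a ∈ L one has a = ⨆_{ω ∈ Ω} (a ⊓ ω) and κ(a) = ⋃_{ω ∈ Ω} κ(a ⊓ ω); moreover for distinct ω, ω' ∈ Ω one has a ⊓ ω ≤ (a ⊓ ω')ᗮ and κ(a ⊓ ω) ∩ κ(a ⊓ ω') = ∅. -/

import Mathlib

/-- A state property system `(σ, L, κ)` equipped with an orthocomplementation
satisfying the axiom **OrthoCom**. -/
structure OrthoSPS (σ : Type*) (L : Type*) [CompleteLattice L] where
  /-- the Cartan map -/
  κ : L → Set σ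
  κ_bot : κ ⊥ = ∅
  κ_top : κ ⊤ = Set.univ
  κ_sInf : ∀ s : Set L, κ (sInf s) = ⋂ a ∈ s, κ a
  le_iff : ∀ a b : L, a ≤ b ↔ κ a ⊆ κ b
  /-- the orthocomplementation -/
  perp : L → L
  perp_perp : ∀ a : L, perp (perp a) = a
  perp_anti : ∀ a b : L, a ≤ b → perp b ≤ perp a
  inf_perp : ∀ a : L, a ⊓ perp a = ⊥
  sup_perp : ∀ a : L, a ⊔ perp a = ⊤
  /-- axiom OrthoCom: any state orthogonal to every state in `κ a` lies in `κ (perp a)` -/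
  orthoCom : ∀ (a : L) (q : σ),
    (∀ p ∈ κ a, ∃ b : L, q ∈ κ b ∧ p ∈ κ (perp b)) → q ∈ κ (perp a)

namespace OrthoSPS

variable {σ : Type*} {L : Type*} [CompleteLattice L]

/-- orthogonality of two states: `p ⊥ q` -/
def PerpState (S : OrthoSPS σ L) (p q : σ) : Prop :=
  ∃ a : L, p ∈ S.κ a ∧ q ∈ S.κ (S.perp a)

/-- a property `a` is classical if every state is in `κ a` or in `κ (perp a)` -/
def IsClassical (S : OrthoSPS σ L) (a : L) : Prop :=
  ∀ p : σ, p ∈ S.κ a ∨ p ∈ S.κ (S.perp a)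

/-- the classical state `ω p` of a state `p`: the infimum of all classical properties
actual in `p` -/
def classicalState (S : OrthoSPS σ L) (p : σ) : L :=
  sInf {a : L | S.IsClassical a ∧ p ∈ S.κ a}

/-- `Ω`, the set of all classical states -/
def Omega (S : OrthoSPS σ L) : Set L :=
  Set.range S.classicalState

/-- the classical Cartan map `κ_c` -/
def κc (S : OrthoSPS σ L) (a : L) : Set L :=
  S.classicalState '' S.κ a

end OrthoSPS

namespace OrthoSPS

variable {σ : Type*} {L : Type*} [CompleteLattice L]

theorem κ_mono (S : OrthoSPS σ L) {a b : L} (h : a ≤ b) : S.κ a ⊆ S.κ b :=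
  (S.le_iff a b).1 h

theorem κ_inf (S : OrthoSPS σ L) (a b : L) : S.κ (a ⊓ b) = S.κ a ∩ S.κ b := by
  rw [← sInf_pair, S.κ_sInf, Set.biInter_pair]

theorem κ_inter_κ_perp (S : OrthoSPS σ L) (a : L) : S.κ a ∩ S.κ (S.perp a) = ∅ := by
  rw [← S.κ_inf, S.inf_perp, S.κ_bot]

theorem IsClassical.perp {S : OrthoSPS σ L} {a : L} (h : S.IsClassical a) :
    S.IsClassical (S.perp a) := fun p => by
  rw [S.perp_perp]
  exact (h p).symm

theorem mem_κ_classicalState (S : OrthoSPS σ L) (p : σ) : p ∈ S.κ (S.classicalState p) := by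
  rw [classicalState, S.κ_sInf]
  exact Set.mem_iInter₂.2 fun _ h => h.2

theorem classicalState_le {S : OrthoSPS σ L} {a : L} (h : S.IsClassical a) {p : σ}
    (hp : p ∈ S.κ a) : S.classicalState p ≤ a :=
  sInf_le ⟨h, hp⟩

/-- A state in which every classical property of `p` is actual has the same classical state
as `p`. -/
theorem classicalState_eq_of_forall {S : OrthoSPS σ L} {p q : σ}
    (h : ∀ c, S.IsClassical c → p ∈ S.κ c → q ∈ S.κ c) :
    S.classicalState p = S.classicalState q := by
  refine congrArg sInf (Set.ext fun c => ⟨fun hc => ⟨hc.1, h c hc.1 hc.2⟩, fun hc => ⟨hc.1, ?_⟩⟩)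
  refine (hc.1 p).resolve_right fun hp => ?_
  exact (S.κ_inter_κ_perp c).le ⟨hc.2, h _ hc.1.perp hp⟩

/-- Distinct classical states are orthogonal. -/
theorem classicalState_le_perp {S : OrthoSPS σ L} {p q : σ}
    (h : S.classicalState p ≠ S.classicalState q) :
    S.classicalState p ≤ S.perp (S.classicalState q) := by
  obtain ⟨c, hc, hp, hq⟩ : ∃ c, S.IsClassical c ∧ p ∈ S.κ c ∧ q ∉ S.κ c := by
    by_contra! H
    exact h (classicalState_eq_of_forall H)
  calc S.classicalState p ≤ c := classicalState_le hc hp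
    _ = S.perp (S.perp c) := (S.perp_perp c).symm
    _ ≤ S.perp (S.classicalState q) :=
      S.perp_anti _ _ (classicalState_le hc.perp ((hc q).resolve_left hq))

theorem κ_inter_eq_empty_of_le_perp (S : OrthoSPS σ L) {a b : L} (h : a ≤ S.perp b) :
    S.κ a ∩ S.κ b = ∅ :=
  Set.subset_empty_iff.1 fun _ hx => (S.κ_inter_κ_perp b).le ⟨hx.2, S.κ_mono h hx.1⟩

theorem κ_eq_iUnion_κ_inf_classicalState (S : OrthoSPS σ L) (a : L) :
    S.κ a = ⋃ w ∈ S.Omega, S.κ (a ⊓ w) := by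
  refine Set.Subset.antisymm (fun p hp => ?_)
    (Set.iUnion₂_subset fun w _ => S.κ_mono inf_le_left)
  refine Set.mem_biUnion (Set.mem_range_self p) ?_
  rw [S.κ_inf]
  exact ⟨hp, S.mem_κ_classicalState p⟩

end OrthoSPS

/-- every property decomposes over the classical states:
`a = ⨆_{ω ∈ Ω} (a ⊓ ω)`, `κ a = ⋃_{ω ∈ Ω} κ (a ⊓ ω)`, and the pieces are mutually
orthogonal with disjoint Cartan images. -/
theorem decompose_over_Omega {σ L : Type*} [CompleteLattice L] (S : OrthoSPS σ L)
    (a : L) :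
    a = (⨆ w ∈ S.Omega, a ⊓ w) ∧
    S.κ a = (⋃ w ∈ S.Omega, S.κ (a ⊓ w)) ∧
    (∀ w ∈ S.Omega, ∀ w' ∈ S.Omega, w ≠ w' →
      a ⊓ w ≤ S.perp (a ⊓ w') ∧ S.κ (a ⊓ w) ∩ S.κ (a ⊓ w') = ∅) := by
  refine ⟨le_antisymm ?_ (iSup₂_le fun _ _ => inf_le_left),
    S.κ_eq_iUnion_κ_inf_classicalState a, ?_⟩
  · rw [S.le_iff]
    conv_lhs => rw [S.κ_eq_iUnion_κ_inf_classicalState a]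
    exact Set.iUnion₂_subset fun w hw => S.κ_mono (le_iSup₂ (f := fun w _ => a ⊓ w) w hw)
  · rintro _ ⟨p, rfl⟩ _ ⟨q, rfl⟩ h
    have hle : a ⊓ S.classicalState p ≤ S.perp (a ⊓ S.classicalState q) :=
      inf_le_right.trans ((OrthoSPS.classicalState_le_perp h).trans
        (S.perp_anti _ _ inf_le_right))
    exact ⟨hle, S.κ_inter_eq_empty_of_le_perp hle⟩
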